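/- Let X be a special (abstract) rank one group with unipotent subgroups A and B. Then a₁ ∈ a₂·(A ∩ [X,X]) for all 1 ≠ a₁ ∈ A and 1 ≠ a₂ ∈ A with a₁a₂ ≠ 1; that is, a₂⁻¹a₁ lies in A ∩ [X,X]. -/

import Mathlib

/-- The conjugate subgroup `S^g = g⁻¹ S g`. -/
def conjSub {X : Type*} [Group X] (S : Subgroup X) (g : X) : Subgroup X :=
  S.map (MulAut.conj g⁻¹).toMonoidHom

/-- `X` is an (abstract) rank one group with unipotent subgroups `A` and `B`:
`A ≠ B`, `X = ⟨A, B⟩`, for each `1 ≠ a ∈ A` there is `1 ≠ b ∈ B` with `A^b = B^a`,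
and vice versa. -/
structure IsRankOneGroup {X : Type*} [Group X] (A B : Subgroup X) : Prop where
  ne : A ≠ B
  gen : A ⊔ B = ⊤
  exB : ∀ a ∈ A, a ≠ 1 → ∃ b ∈ B, b ≠ 1 ∧ conjSub A b = conjSub B a
  exA : ∀ b ∈ B, b ≠ 1 → ∃ a ∈ A, a ≠ 1 ∧ conjSub B a = conjSub A b

/-- `bf` implements `a ↦ b(a)`, the unique `1 ≠ b ∈ B` with `A^b = B^a`, for `1 ≠ a ∈ A`. -/
def IsBFun {X : Type*} [Group X] (A B : Subgroup X) (bf : X → X) : Prop :=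
  ∀ a ∈ A, a ≠ 1 → bf a ∈ B ∧ bf a ≠ 1 ∧ conjSub A (bf a) = conjSub B a

/-- `af` implements `b ↦ a(b)`, the unique `1 ≠ a ∈ A` with `B^a = A^b`, for `1 ≠ b ∈ B`. -/
def IsAFun {X : Type*} [Group X] (A B : Subgroup X) (af : X → X) : Prop :=
  ∀ b ∈ B, b ≠ 1 → af b ∈ A ∧ af b ≠ 1 ∧ conjSub B (af b) = conjSub A b

/-- `X` is special: `b(a⁻¹) = b(a)⁻¹` for all `1 ≠ a ∈ A`. -/
def IsSpecialBFun {X : Type*} [Group X] (A B : Subgroup X) (bf : X → X) : Prop :=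
  IsBFun A B bf ∧ ∀ a ∈ A, a ≠ 1 → bf a⁻¹ = (bf a)⁻¹

/-- The special rank one group condition, phrased without a chosen `b`-function. -/
def IsSpecial {X : Type*} [Group X] (A B : Subgroup X) : Prop :=
  ∃ bf : X → X, IsSpecialBFun A B bf

section ConjSub

variable {X : Type*} [Group X]

theorem conjSub_mul (S : Subgroup X) (g k : X) :
    conjSub S (g * k) = conjSub (conjSub S g) k := by
  simp only [conjSub, Subgroup.map_map]
  congr 1
  ext x
  simp [mul_assoc]

theorem conjSub_one (S : Subgroup X) : conjSub S 1 = S := by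
  ext x
  simp [conjSub]

theorem conj_mem_conjSub {S : Subgroup X} {s : X} (hs : s ∈ S) (g : X) :
    g⁻¹ * s * g ∈ conjSub S g :=
  ⟨s, hs, by simp⟩

theorem conjSub_of_mem {S : Subgroup X} {g : X} (hg : g ∈ S) : conjSub S g = S := by
  ext x
  constructor
  · rintro ⟨s, hs, rfl⟩
    simpa using S.mul_mem (S.mul_mem (S.inv_mem hg) hs) hg
  · intro hx
    exact ⟨g * x * g⁻¹, S.mul_mem (S.mul_mem hg hx) (S.inv_mem hg), by simp [mul_assoc]⟩

theorem conjSub_mul_of_mem {S : Subgroup X} {g : X} (hg : g ∈ S) (k : X) :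
    conjSub S (g * k) = conjSub S k := by
  rw [conjSub_mul, conjSub_of_mem hg]

theorem conjSub_mul_inv_eq_self {S : Subgroup X} {g k : X} (hgk : conjSub S g = conjSub S k) :
    conjSub S (g * k⁻¹) = S := by
  rw [conjSub_mul, hgk, ← conjSub_mul, mul_inv_cancel, conjSub_one]

end ConjSub

namespace IsRankOneGroup

variable {X : Type*} [Group X] {A B : Subgroup X}

theorem symm (h : IsRankOneGroup A B) : IsRankOneGroup B A :=
  ⟨h.ne.symm, sup_comm A B ▸ h.gen, h.exA, h.exB⟩

theorem eq_one_of_conjSub_eq (h : IsRankOneGroup A B) {b : X} (hb : b ∈ B)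
    (hAb : conjSub A b = A) : b = 1 := by
  by_contra hb1
  obtain ⟨a, ha, -, hab⟩ := h.exA b hb hb1
  apply h.ne
  have hBa : conjSub B a = conjSub A a := by rw [hab, hAb, conjSub_of_mem ha]
  have := congrArg (fun S => conjSub S a⁻¹) hBa
  simpa only [← conjSub_mul, mul_inv_cancel, conjSub_one] using this.symm

theorem eq_of_conjSub_eq (h : IsRankOneGroup A B) {b b' : X} (hb : b ∈ B) (hb' : b' ∈ B)
    (hbb' : conjSub A b = conjSub A b') : b = b' :=
  mul_inv_eq_one.1 <| h.eq_one_of_conjSub_eq (B.mul_mem hb (B.inv_mem hb'))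
    (conjSub_mul_inv_eq_self hbb')

variable {bf : X → X}

/-- The element `a b(a)⁻¹ a` conjugates `A` to `B`. -/
theorem conjSub_left_swap (hbf : IsSpecialBFun A B bf) {a : X} (ha : a ∈ A) (ha1 : a ≠ 1) :
    conjSub A (a * (bf a)⁻¹ * a) = B := by
  have hinv := (hbf.1 a⁻¹ (A.inv_mem ha) (inv_ne_one.2 ha1)).2.2
  rw [hbf.2 a ha ha1] at hinv
  rw [mul_assoc, conjSub_mul_of_mem ha, conjSub_mul, hinv, ← conjSub_mul, inv_mul_cancel,
    conjSub_one]

/-- The element `a b(a)⁻¹ a` conjugates `B` to `A`. -/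
theorem conjSub_right_swap (hbf : IsBFun A B bf) {a : X} (ha : a ∈ A) (ha1 : a ≠ 1) :
    conjSub B (a * (bf a)⁻¹ * a) = A := by
  rw [conjSub_mul, conjSub_mul, ← (hbf a ha ha1).2.2, ← conjSub_mul A, mul_inv_cancel,
    conjSub_one, conjSub_of_mem ha]

theorem bFun_eq_conj (h : IsRankOneGroup A B) (hbf : IsSpecialBFun A B bf) {a : X}
    (ha : a ∈ A) (ha1 : a ≠ 1) :
    bf a = (a * (bf a)⁻¹ * a)⁻¹ * a⁻¹ * (a * (bf a)⁻¹ * a) := by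
  obtain ⟨hb, -, hab⟩ := hbf.1 a ha ha1
  refine h.eq_of_conjSub_eq hb ?_ ?_
  · conv_lhs => rw [← conjSub_left_swap hbf ha ha1]
    exact conj_mem_conjSub (A.inv_mem ha) _
  · have hn : (a * (bf a)⁻¹ * a)⁻¹ * a⁻¹ * (a * (bf a)⁻¹ * a)
        = a⁻¹ * (bf a * (a⁻¹ * ((bf a)⁻¹ * a))) := by group
    rw [hn, conjSub_mul_of_mem (A.inv_mem ha), conjSub_mul, hab, ← conjSub_mul,
      mul_inv_cancel_left, conjSub_mul_of_mem (B.inv_mem hb)]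

variable {V : Type*} [CommGroup V]

theorem map_eq_inv_map (h : IsRankOneGroup A B) (hbf : IsSpecialBFun A B bf) (φ : X →* V)
    {a b : X} (ha : a ∈ A) (ha1 : a ≠ 1) (hb : b ∈ B) (hab : conjSub A b = conjSub B a) :
    φ b = (φ a)⁻¹ := by
  obtain ⟨hb', -, hab'⟩ := hbf.1 a ha ha1
  rw [h.eq_of_conjSub_eq hb hb' (hab.trans hab'.symm), h.bFun_eq_conj hbf ha ha1]
  simp only [map_mul, map_inv]
  rw [mul_right_comm, inv_mul_cancel, one_mul]

/-- A homomorphism `φ` to a commutative group satisfies `φ(a₁)² = φ(a₂)` for distinct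
nontrivial `a₁, a₂ ∈ A`. -/
theorem map_mul_self_eq (h : IsRankOneGroup A B) (hbf : IsSpecialBFun A B bf) (φ : X →* V)
    {a₁ a₂ : X} (h₁ : a₁ ∈ A) (h₁' : a₁ ≠ 1) (h₂ : a₂ ∈ A) (h₂' : a₂ ≠ 1) (hne : a₁ ≠ a₂) :
    φ a₁ * φ a₁ = φ a₂ := by
  obtain ⟨hb₁, -, hab₁⟩ := hbf.1 a₁ h₁ h₁'
  obtain ⟨hb₂, -, hab₂⟩ := hbf.1 a₂ h₂ h₂'
  have hbne : bf a₁ * (bf a₂)⁻¹ ≠ 1 := fun hb => hne <|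
    h.symm.eq_of_conjSub_eq h₁ h₂ <| by rw [← hab₁, ← hab₂, mul_inv_eq_one.1 hb]
  have hbmem := B.mul_mem hb₁ (B.inv_mem hb₂)
  obtain ⟨c, hc, hc1, hcb⟩ := h.exA _ hbmem hbne
  have hφc := h.map_eq_inv_map hbf φ hc hc1 hbmem hcb.symm
  set n := a₂ * (bf a₂)⁻¹ * a₂ with hn
  have hx : a₁ * a₂⁻¹ ∈ A := A.mul_mem h₁ (A.inv_mem h₂)
  have hxn : n⁻¹ * (a₁ * a₂⁻¹) * n ∈ B := by
    conv_lhs => rw [← conjSub_left_swap hbf h₂ h₂']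
    exact conj_mem_conjSub hx n
  have hxn1 : n⁻¹ * (a₁ * a₂⁻¹) * n ≠ 1 := by
    intro hx1
    apply hne
    rw [← mul_inv_eq_one, ← conj_eq_one_iff (a := n⁻¹), inv_inv, hx1]
  obtain ⟨y, hy, hy1, hyx⟩ := h.exA _ hxn hxn1
  have hφy := h.map_eq_inv_map hbf φ hy hy1 hxn hyx.symm
  have hcy : c = y * a₂⁻¹ := by
    refine h.symm.eq_of_conjSub_eq hc (A.mul_mem hy (A.inv_mem h₂)) ?_
    have hBn : conjSub B n = A := conjSub_right_swap hbf.1 h₂ h₂'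
    have hb : (bf a₂)⁻¹ = a₂⁻¹ * n * a₂⁻¹ := by rw [hn]; group
    calc conjSub B c = conjSub (conjSub B a₁) (bf a₂)⁻¹ := by rw [hcb, conjSub_mul, hab₁]
      _ = conjSub B (n * (n⁻¹ * (a₁ * a₂⁻¹) * n) * a₂⁻¹) := by
        rw [← conjSub_mul, hb]; congr 1; group
      _ = conjSub B (y * a₂⁻¹) := by
        rw [conjSub_mul, conjSub_mul, hBn, ← hyx, ← conjSub_mul]
  have hφb₁ := h.map_eq_inv_map hbf φ h₁ h₁' hb₁ hab₁
  have hφb₂ := h.map_eq_inv_map hbf φ h₂ h₂' hb₂ hab₂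
  have hφx : (φ y)⁻¹ = φ a₁ * (φ a₂)⁻¹ := by
    rw [← hφy]
    simp only [map_mul, map_inv]
    rw [mul_right_comm, inv_mul_cancel, one_mul]
  rw [hcy] at hφc
  simp only [map_mul, map_inv, hφb₁, hφb₂, inv_inv, mul_inv, hφx] at hφc
  rw [inv_mul_cancel_right, inv_mul_eq_iff_eq_mul] at hφc
  exact hφc.symm

end IsRankOneGroup

/-- In a special rank one group, `a₁ ∈ a₂·(A ∩ [X,X])` for all `1 ≠ a₁, a₂ ∈ A`
with `a₁a₂ ≠ 1`. -/
theorem specialRankOne_equation_in_A {X : Type*} [Group X] (A B : Subgroup X)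
    (h : IsRankOneGroup A B) (hsp : IsSpecial A B) :
    ∀ a₁ ∈ A, a₁ ≠ 1 → ∀ a₂ ∈ A, a₂ ≠ 1 → a₁ * a₂ ≠ 1 →
      a₂⁻¹ * a₁ ∈ A ⊓ commutator X := by
  intro a₁ h₁ h₁' a₂ h₂ h₂' hne
  obtain ⟨bf, hbf⟩ := hsp
  refine Subgroup.mem_inf.2 ⟨A.mul_mem (A.inv_mem h₂) h₁, ?_⟩
  rcases eq_or_ne a₁ a₂ with rfl | hne'
  · simp
  rw [← Abelianization.ker_of X, MonoidHom.mem_ker, map_mul, map_inv,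
    inv_mul_eq_one]
  have e₁ := h.map_mul_self_eq hbf Abelianization.of h₁ h₁' h₂ h₂' hne'
  have e₂ := h.map_mul_self_eq hbf Abelianization.of h₂ h₂' h₁ h₁' hne'.symm
  have e₃ := h.map_mul_self_eq hbf Abelianization.of h₁ h₁' (A.inv_mem h₂) (inv_ne_one.2 h₂')
    (fun he => hne (by rw [he, inv_mul_cancel]))
  rw [e₁, map_inv, eq_inv_iff_mul_eq_one, e₂] at e₃
  rw [← e₁, e₃, one_mul]
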